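/- The pseudovariety A of finite aperiodic semigroups is κ-reducible for idempotent pointlike sets: let S be a finite semigroup and P an A-idempotent pointlike subset of S. Then for every finite alphabet A and every surjective homomorphism φ: A⁺ → S from the free semigroup on A, there exists a family (w_p)_{p∈P} of κ-terms over A such that, for each p ∈ P, w_p evaluates to p in S under the letter assignment given by φ restricted to A, and for every finite aperiodic semigroup T and every map from A to T, all the terms w_p evaluate to one and the same idempotent element of T. -/

import Mathlib

/-- `spow s n` is the power `s^(n+1)` of `s`, defined in any magma. -/
def spow {S : Type*} [Mul S] (s : S) (n : ℕ) : S := (fun x => x * s)^[n] s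

/-- A finite semigroup is aperiodic if for every element `s` there is `m` with
`s^m = s^(m+1)`. -/
def IsAperiodic (T : Type) [Semigroup T] : Prop :=
  ∀ t : T, ∃ m : ℕ, spow t m = spow t (m + 1)

/-- κ-terms over the alphabet `A`: letters, binary multiplication and the
unary `(ω-1)`-power. -/
inductive KTerm (A : Type) : Type
  | letter : A → KTerm A
  | mul : KTerm A → KTerm A → KTerm A
  | ommPow : KTerm A → KTerm A

/-- The evaluation relation for κ-terms in a semigroup `T`, given an assignment
`f` of letters.  The `(ω-1)`-power of an element `s` is the element `g` of the
cyclic subsemigroup generated by `s` such that `g * s = s * g = e` and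
`g * e = g`, where `e` is the (unique, in a finite semigroup) idempotent power
`s^ω` of `s`. -/
inductive KEval {A T : Type} [Semigroup T] (f : A → T) : KTerm A → T → Prop
  | letter (a : A) : KEval f (KTerm.letter a) (f a)
  | mul {u v : KTerm A} {s t : T} :
      KEval f u s → KEval f v t → KEval f (KTerm.mul u v) (s * t)
  | ommPow {u : KTerm A} {s e g : T} :
      KEval f u s →
      IsIdempotentElem e → (∃ n : ℕ, spow s n = e) →
      (∃ n : ℕ, spow s n = g) →
      g * s = e → s * g = e → g * e = g →
      KEval f (KTerm.ommPow u) g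

/-- `P` is idempotent pointlike for the pseudovariety of finite aperiodic
semigroups: for every finite aperiodic semigroup `T` and every subsemigroup `R`
of `S × T` projecting onto `S`, some idempotent `t ∈ T` is related to every
element of `P`. -/
def IsAperiodicIdempotentPointlike {S : Type} [Semigroup S] (P : Set S) : Prop :=
  ∀ (T : Type) [Semigroup T] [Finite T], IsAperiodic T →
    ∀ R : Subsemigroup (S × T),
      (∀ s : S, ∃ t : T, (s, t) ∈ R) →
      ∃ t : T, IsIdempotentElem t ∧ ∀ p ∈ P, (p, t) ∈ R

/-- Ordered monoids with an operation bounding all large powers. -/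
class NatOM (F : Type) extends Monoid F, Preorder F where
  mul_le : ∀ a b c d : F, a ≤ b → c ≤ d → a * c ≤ b * d
  nat : F → F
  pow_le_nat : ∃ N : ℕ, ∀ x : F, ∀ m, N ≤ m → x ^ m ≤ nat x
  nat_comm : ∀ x c y : F, x * c = c * y → nat x * c = c * nat y

/-- The local divisor of `F` at `c`. -/
def LocDiv {F : Type} [Monoid F] (c : F) : Type :=
  {x : F // (∃ y, x = y * c) ∧ (∃ y, x = c * y)}

namespace LocDiv
variable {F : Type}

noncomputable def lf [Monoid F] {c : F} (a : LocDiv c) : F := a.2.1.choose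
noncomputable def rt [Monoid F] {c : F} (a : LocDiv c) : F := a.2.2.choose

theorem lf_spec [Monoid F] {c : F} (a : LocDiv c) : a.1 = a.lf * c := a.2.1.choose_spec
theorem rt_spec [Monoid F] {c : F} (a : LocDiv c) : a.1 = c * a.rt := a.2.2.choose_spec

theorem lf_mul [Monoid F] {c : F} (a b : LocDiv c) (x : F) (h : a.1 = x * c) :
    a.lf * b.1 = x * b.1 := by
  rw [rt_spec b, ← mul_assoc, ← mul_assoc, ← lf_spec, h]

noncomputable def mul' [Monoid F] {c : F} (a b : LocDiv c) : LocDiv c :=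
  ⟨a.lf * b.1, ⟨a.lf * b.lf, by rw [mul_assoc, ← lf_spec]⟩,
    ⟨a.rt * b.rt, by rw [rt_spec b, ← mul_assoc, ← lf_spec, ← mul_assoc, ← rt_spec]⟩⟩

noncomputable def nat' [NatOM F] {c : F} (a : LocDiv c) : LocDiv c :=
  ⟨NatOM.nat a.lf * c, ⟨_, rfl⟩,
    ⟨NatOM.nat a.rt, NatOM.nat_comm _ _ _ (by rw [← lf_spec, rt_spec])⟩⟩

theorem nat'_eq [NatOM F] {c : F} (a : LocDiv c) (x : F) (h : a.1 = x * c) :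
    a.nat'.1 = NatOM.nat x * c := by
  change NatOM.nat a.lf * c = _
  rw [NatOM.nat_comm a.lf c a.rt (by rw [← lf_spec, rt_spec]),
    NatOM.nat_comm x c a.rt (by rw [← h, rt_spec])]

noncomputable instance [Monoid F] (c : F) : Monoid (LocDiv c) where
  mul := mul'
  one := ⟨c, ⟨1, by simp⟩, ⟨1, by simp⟩⟩
  mul_assoc a b d := by
    apply Subtype.ext
    change (mul' a b).lf * d.1 = a.lf * (b.lf * d.1)
    rw [lf_mul _ d (a.lf * b.lf), mul_assoc]
    change a.lf * b.1 = _
    rw [mul_assoc, ← lf_spec]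
  one_mul a := by
    apply Subtype.ext
    change (lf _) * a.1 = a.1
    rw [lf_mul _ a 1, one_mul]
    exact (one_mul c).symm
  mul_one a := by
    apply Subtype.ext
    exact (lf_spec a).symm

theorem val_mul [Monoid F] {c : F} (a b : LocDiv c) : (a * b).1 = a.lf * b.1 := rfl
theorem val_one [Monoid F] {c : F} : (1 : LocDiv c).1 = c := rfl

theorem val_pow [Monoid F] {c : F} (a : LocDiv c) (x : F) (h : a.1 = x * c) (n : ℕ) :
    (a ^ n).1 = x ^ n * c := by
  induction n with
  | zero => simp [val_one]
  | succ n ih => rw [pow_succ', val_mul, lf_mul _ _ x h, ih, pow_succ', mul_assoc]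

noncomputable instance [NatOM F] (c : F) : NatOM (LocDiv c) where
  le a b := a.1 ≤ b.1
  le_refl a := le_refl a.1
  le_trans a b d h1 h2 := le_trans (α := F) h1 h2
  mul_le a b d e h1 h2 := by
    change a.lf * d.1 ≤ b.lf * e.1
    have h3 : a.lf * d.1 ≤ b.lf * d.1 := by
      rw [rt_spec d, ← mul_assoc, ← mul_assoc, ← lf_spec, ← lf_spec]
      exact NatOM.mul_le _ _ _ _ h1 le_rfl
    exact h3.trans (NatOM.mul_le _ _ _ _ le_rfl h2)
  nat := nat'
  pow_le_nat := by
    obtain ⟨N, hN⟩ := NatOM.pow_le_nat (F := F)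
    refine ⟨N, fun x m hm => ?_⟩
    change (x ^ m).1 ≤ x.nat'.1
    rw [val_pow x x.lf (lf_spec x), nat'_eq x x.lf (lf_spec x)]
    exact NatOM.mul_le _ _ _ _ (hN _ _ hm) le_rfl
  nat_comm a d b h := by
    have h' : a.lf * d.1 = d.1 * b.rt := by
      have := congrArg Subtype.val h
      rw [val_mul, val_mul, rt_spec b, ← mul_assoc, ← lf_spec] at this
      exact this
    apply Subtype.ext
    rw [val_mul, val_mul, lf_mul _ _ (NatOM.nat a.lf) (nat'_eq a _ (lf_spec a)),
      NatOM.nat_comm _ _ _ h']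
    change _ = d.lf * (NatOM.nat b.lf * c)
    rw [NatOM.nat_comm b.lf c b.rt (by rw [← lf_spec, rt_spec]), ← mul_assoc, ← lf_spec]

end LocDiv

/-- The carrier of the composite monoid of the induction step. -/
inductive BR {E M : Type} (δ : E → M) : Type
  | base : E → BR δ
  | tri : E → M → E → BR δ

namespace BR
variable {E M : Type} [Monoid E] [Monoid M] {δ : E → M}

def mul' : BR δ → BR δ → BR δ
  | base e, base f => base (e * f)
  | base e, tri u m v => tri (e * u) m v
  | tri u m v, base e => tri u m (v * e)
  | tri u m v, tri u' m' v' => tri u (m * δ (v * u') * m') v'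

instance : Monoid (BR δ) where
  mul := mul'
  one := base 1
  mul_assoc a b c := by
    change mul' (mul' a b) c = mul' a (mul' b c)
    cases a <;> cases b <;> cases c <;> simp [mul', mul_assoc]
  one_mul a := by
    change mul' (base 1) a = a
    cases a <;> simp [mul']
  mul_one a := by
    change mul' a (base 1) = a
    cases a <;> simp [mul']

theorem base_mul (e f : E) : (base e : BR δ) * base f = base (e * f) := rfl
theorem tri_mul (u : E) (m : M) (v e : E) : (tri u m v : BR δ) * base e = tri u m (v * e) := rfl
theorem base_mul_tri (u : E) (m : M) (v e : E) :
    (base e : BR δ) * tri u m v = tri (e * u) m v := rfl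
theorem tri_mul_tri (u : E) (m : M) (v : E) (u' : E) (m' : M) (v' : E) :
    (tri u m v : BR δ) * tri u' m' v' = tri u (m * δ (v * u') * m') v' := rfl

instance [Finite E] [Finite M] : Finite (BR δ) := by
  apply Finite.of_injective (β := E ⊕ (E × M × E))
    (fun x => match x with
      | base e => Sum.inl e
      | tri u m v => Sum.inr (u, m, v))
  intro a b h
  cases a <;> cases b <;> simp_all

theorem aper (hE : ∀ t : E, ∃ m, t ^ m = t ^ (m + 1)) (hM : ∀ t : M, ∃ m, t ^ m = t ^ (m + 1))
    (t : BR δ) : ∃ m, t ^ m = t ^ (m + 1) := by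
  cases t with
  | base e =>
    have h : ∀ n, (base e : BR δ) ^ n = base (e ^ n) := by
      intro n
      induction n with
      | zero => rw [pow_zero, pow_zero]; rfl
      | succ n ih => rw [pow_succ, ih, base_mul, pow_succ]
    obtain ⟨m, hm⟩ := hE e
    exact ⟨m, by rw [h, h, hm]⟩
  | tri u m v =>
    have h : ∀ n, (tri u m v : BR δ) ^ (n + 1) = tri u (m * (δ (v * u) * m) ^ n) v := by
      intro n
      induction n with
      | zero => simp
      | succ n ih => rw [pow_succ, ih, tri_mul_tri, pow_succ]; simp only [mul_assoc]
    obtain ⟨k, hk⟩ := hM (δ (v * u) * m)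
    exact ⟨k + 1, by rw [h, h, hk]⟩

end BR

/-- Existence of an aperiodic quotient bounding `β`. -/
def AperBound {F B : Type} [NatOM F] (β : FreeMonoid B →* F) : Prop :=
  ∃ (T : Type) (_ : Monoid T), Finite T ∧ (∀ t : T, ∃ m, t ^ m = t ^ (m + 1)) ∧
    ∃ (η : FreeMonoid B →* T) (ub : T → F), ∀ w, β w ≤ ub (η w)

theorem units_bound {F : Type} [NatOM F] [Finite F] :
    ∃ z : F, ∀ g : Fˣ, (g : F) ≤ z := by
  classical
  haveI := Fintype.ofFinite Fˣ
  obtain ⟨N, hN⟩ := NatOM.pow_le_nat (F := F)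
  have h1 : ∀ g : Fˣ, (1 : F) ≤ NatOM.nat (g : F) := by
    intro g
    have := hN (g : F) (N * orderOf g) (Nat.le_mul_of_pos_right _ (orderOf_pos g))
    rwa [mul_comm, pow_mul, ← Units.val_pow_eq_pow_val, pow_orderOf_eq_one, Units.val_one,
      one_pow] at this
  have h2 : ∀ g : Fˣ, (g : F) ≤ NatOM.nat (g : F) := by
    intro g
    have := hN (g : F) (N * orderOf g + 1)
      ((Nat.le_mul_of_pos_right _ (orderOf_pos g)).trans (Nat.le_succ _))
    rwa [pow_succ, mul_comm N, pow_mul, ← Units.val_pow_eq_pow_val, pow_orderOf_eq_one,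
      Units.val_one, one_pow, one_mul] at this
  have h3 : ∀ l : List Fˣ, ∃ z : F, 1 ≤ z ∧ ∀ g ∈ l, (g : F) ≤ z := by
    intro l
    induction l with
    | nil => exact ⟨1, le_rfl, by simp⟩
    | cons a l ih =>
      obtain ⟨z, hz, hl⟩ := ih
      refine ⟨NatOM.nat (a : F) * z, ?_, ?_⟩
      · simpa using NatOM.mul_le _ _ _ _ (h1 a) hz
      · intro g hg
        rcases List.mem_cons.1 hg with rfl | hg
        · simpa using NatOM.mul_le _ _ _ _ (h2 g) hz
        · simpa using NatOM.mul_le _ _ _ _ (h1 a) (hl g hg)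
  obtain ⟨z, _, hz⟩ := h3 (Finset.univ : Finset Fˣ).toList
  exact ⟨z, fun g => hz g (by simp)⟩

theorem aperBound_units {F B : Type} [NatOM F] [Finite F] (β : FreeMonoid B →* F)
    (h : ∀ b, IsUnit (β (FreeMonoid.of b))) : AperBound β := by
  obtain ⟨z, hz⟩ := units_bound (F := F)
  refine ⟨PUnit, inferInstance, inferInstance, fun t => ⟨0, rfl⟩, 1, fun _ => z, fun w => ?_⟩
  have : IsUnit (β w) := by
    induction w using FreeMonoid.inductionOn' with
    | one => simp
    | of_mul b w ih => rw [map_mul]; exact (h b).mul ih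
  obtain ⟨g, hg⟩ := this
  rw [← hg]
  exact hz g

theorem aperBound_step {F B : Type} [NatOM F] [Finite F] (β : FreeMonoid B →* F) (c : B)
    (h1 : ∀ β' : FreeMonoid {b : B // b ≠ c} →* F, AperBound β')
    (h2 : ∀ (E : Type) [Finite E] (γ : FreeMonoid E →* LocDiv (β (FreeMonoid.of c))),
      AperBound γ) : AperBound β := by
  classical
  let β' : FreeMonoid {b : B // b ≠ c} →* F := FreeMonoid.lift (fun b => β (FreeMonoid.of b.1))
  obtain ⟨E, _, hEfin, hEap, η', ub', hub'⟩ := h1 β'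
  let γ0 : E → LocDiv (β (FreeMonoid.of c)) := fun e =>
    ⟨β (FreeMonoid.of c) * ub' e * β (FreeMonoid.of c), ⟨_, rfl⟩, ⟨_, mul_assoc _ _ _⟩⟩
  let γ : FreeMonoid E →* LocDiv (β (FreeMonoid.of c)) := FreeMonoid.lift γ0
  obtain ⟨M, _, hMfin, hMap, δ, ub'', hub''⟩ := h2 E γ
  let δ0 : E → M := fun e => δ (FreeMonoid.of e)
  let η : FreeMonoid B →* BR δ0 := FreeMonoid.lift (fun b =>
    if h : b = c then BR.tri 1 1 1 else BR.base (η' (FreeMonoid.of ⟨b, h⟩)))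
  let ub : BR δ0 → F := fun x => match x with
    | BR.base e => ub' e
    | BR.tri u m v => ub' u * (ub'' m).1 * ub' v
  refine ⟨BR δ0, inferInstance, inferInstance, BR.aper hEap hMap, η, ub, ?_⟩
  have key : ∀ w : List B, (∃ u, η (FreeMonoid.ofList w) = BR.base (η' u) ∧
        β (FreeMonoid.ofList w) = β' u) ∨
      (∃ u l v, η (FreeMonoid.ofList w) = BR.tri (η' u) (δ l) (η' v) ∧
        β (FreeMonoid.ofList w) ≤ β' u * (γ l).1 * β' v) := by
    intro w
    induction w using List.reverseRecOn with
    | nil => exact Or.inl ⟨1, by simp; rfl, by simp⟩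
    | append_singleton w b ih =>
      have e1 : FreeMonoid.ofList (w ++ [b]) = FreeMonoid.ofList w * FreeMonoid.of b := rfl
      rw [e1, map_mul, map_mul]
      by_cases hb : b = c
      · subst hb
        have hη : η (FreeMonoid.of b) = BR.tri 1 1 1 := by simp [η]
        right
        rcases ih with ⟨u, hu1, hu2⟩ | ⟨u, l, v, h3, h4⟩
        · refine ⟨u, 1, 1, ?_, ?_⟩
          · rw [hu1, hη, BR.base_mul_tri]; simp
          · rw [hu2, map_one, map_one, mul_one]; exact le_rfl
        · refine ⟨u, l * FreeMonoid.of (η' v), 1, ?_, ?_⟩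
          · rw [h3, hη, BR.tri_mul_tri]; simp [δ0]
          · have h5 : (γ (l * FreeMonoid.of (η' v))).1
                = (γ l).1 * ub' (η' v) * β (FreeMonoid.of b) := by
              rw [map_mul, LocDiv.val_mul]
              have : γ (FreeMonoid.of (η' v)) = γ0 (η' v) := FreeMonoid.lift_eval_of _ _
              rw [this]
              change (γ l).lf * (β (FreeMonoid.of b) * ub' (η' v) * β (FreeMonoid.of b)) = _
              rw [← mul_assoc, ← mul_assoc, ← LocDiv.lf_spec]
            rw [h5, map_one, mul_one]
            refine (NatOM.mul_le _ _ _ _ h4 (le_refl (β (FreeMonoid.of b)))).trans ?_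
            simp only [← mul_assoc]
            exact NatOM.mul_le _ _ _ _ (NatOM.mul_le _ _ _ _ le_rfl (hub' v)) le_rfl
      · have hη : η (FreeMonoid.of b) = BR.base (η' (FreeMonoid.of ⟨b, hb⟩)) := by simp [η, hb]
        have hβ : β (FreeMonoid.of b) = β' (FreeMonoid.of ⟨b, hb⟩) := by simp [β']
        rcases ih with ⟨u, hu1, hu2⟩ | ⟨u, l, v, h3, h4⟩
        · left
          refine ⟨u * FreeMonoid.of ⟨b, hb⟩, ?_, ?_⟩
          · rw [hu1, hη, BR.base_mul, map_mul]
          · rw [hu2, hβ, map_mul]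
        · right
          refine ⟨u, l, v * FreeMonoid.of ⟨b, hb⟩, ?_, ?_⟩
          · rw [h3, hη, BR.tri_mul, map_mul]
          · rw [hβ, map_mul β' v, ← mul_assoc]
            exact NatOM.mul_le _ _ _ _ h4 le_rfl
  intro w
  rcases key w.toList with ⟨u, hu1, hu2⟩ | ⟨u, l, v, h3, h4⟩
  · rw [FreeMonoid.ofList_toList] at hu1 hu2
    rw [hu1, hu2]
    exact hub' u
  · rw [FreeMonoid.ofList_toList] at h3 h4
    rw [h3]
    exact h4.trans (NatOM.mul_le _ _ _ _ (NatOM.mul_le _ _ _ _ (hub' u) (hub'' l)) (hub' v))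

theorem aperBound_all (n : ℕ) : ∀ (F : Type) [NatOM F] [Finite F], Nat.card F = n →
    ∀ (k : ℕ) (B : Type) [Finite B], Nat.card B = k → ∀ β : FreeMonoid B →* F, AperBound β := by
  induction n using Nat.strong_induction_on with
  | _ n ihn =>
    intro F _ _ hF k
    induction k using Nat.strong_induction_on with
    | _ k ihk =>
      intro B _ hB β
      by_cases h : ∀ b, IsUnit (β (FreeMonoid.of b))
      · exact aperBound_units β h
      · push Not at h
        obtain ⟨c, hc⟩ := h
        apply aperBound_step β c
        · intro β'
          refine ihk _ ?_ _ rfl β'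
          rw [← hB]
          exact Finite.card_subtype_lt (x := c) (by simp)
        · intro E _ γ
          haveI : Finite (LocDiv (β (FreeMonoid.of c))) := Subtype.finite
          refine ihn _ ?_ _ rfl _ E rfl γ
          rw [← hF]
          refine Finite.card_subtype_lt (x := (1 : F)) ?_
          rintro ⟨⟨y, hy⟩, ⟨z, hz⟩⟩
          apply hc
          rw [isUnit_iff_exists_and_exists]
          exact ⟨⟨z, hz.symm⟩, ⟨y, hy.symm⟩⟩

theorem coe_spow {S : Type} [Semigroup S] (s : S) (n : ℕ) :
    ((spow s n : S) : WithOne S) = (s : WithOne S) ^ (n + 1) := by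
  induction n with
  | zero => simp [spow]
  | succ n ih =>
    have : spow s (n + 1) = spow s n * s := by
      simp only [spow, Function.iterate_succ_apply']
    rw [this, WithOne.coe_mul, ih, ← pow_succ]

theorem spow_eq_pow {M : Type} [Monoid M] (s : M) (n : ℕ) : spow s n = s ^ (n + 1) := by
  induction n with
  | zero => simp [spow]
  | succ n ih =>
    have : spow s (n + 1) = spow s n * s := by
      simp only [spow, Function.iterate_succ_apply']
    rw [this, ih, ← pow_succ]

theorem spow_spow {S : Type} [Semigroup S] (s : S) (m n : ℕ) :
    spow (spow s m) n = spow s ((m + 1) * (n + 1) - 1) := by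
  apply WithOne.coe_injective
  rw [coe_spow, coe_spow, coe_spow, ← pow_mul]
  congr 1

instance finite_withOne {S : Type} [Finite S] : Finite (WithOne S) :=
  inferInstanceAs (Finite (Option S))

theorem exists_idem_pow {M : Type} [Monoid M] [Finite M] (x : M) :
    ∃ n : ℕ, 0 < n ∧ x ^ n * x ^ n = x ^ n := by
  obtain ⟨a, b, hab, h⟩ := Finite.exists_ne_map_eq_of_infinite (fun n : ℕ => x ^ n)
  wlog hlt : a < b generalizing a b
  · exact this b a hab.symm h.symm (by omega)
  obtain ⟨d, rfl⟩ := Nat.exists_eq_add_of_lt hlt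
  have h1 : ∀ k c, a ≤ c → x ^ (c + k * (d + 1)) = x ^ c := by
    intro k
    induction k with
    | zero => intro c _; simp
    | succ k ih =>
      intro c hc
      obtain ⟨e, rfl⟩ := Nat.exists_eq_add_of_le hc
      have e1 : a + e + (k + 1) * (d + 1) = (a + d + 1) + (e + k * (d + 1)) := by ring
      have h' : x ^ a = x ^ (a + d + 1) := h
      rw [e1, pow_add, ← h', ← pow_add, ← add_assoc, ih _ hc]
  refine ⟨(a + 1) * (d + 1), by positivity, ?_⟩
  rw [← pow_add]
  exact h1 _ _ (by nlinarith)

theorem exists_omega {S : Type} [Semigroup S] [Finite S] (s : S) :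
    ∃ e g : S, IsIdempotentElem e ∧ (∃ n, spow s n = e) ∧ (∃ n, spow s n = g) ∧
      g * s = e ∧ s * g = e ∧ g * e = g := by
  obtain ⟨n, hn, h⟩ := exists_idem_pow (s : WithOne S)
  obtain ⟨k, rfl⟩ := Nat.exists_eq_add_of_lt hn
  rw [zero_add] at h
  have h2 : (s : WithOne S) ^ (2 * k + 2) = (s : WithOne S) ^ (k + 1) := by
    rw [← h, ← pow_add]; congr 1; omega
  refine ⟨spow s k, spow s (2 * k), ?_, ⟨_, rfl⟩, ⟨_, rfl⟩, ?_, ?_, ?_⟩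
  · apply WithOne.coe_injective
    rw [WithOne.coe_mul, coe_spow, h]
  · apply WithOne.coe_injective
    rw [WithOne.coe_mul, coe_spow, coe_spow, ← pow_succ, ← h2]
  · apply WithOne.coe_injective
    rw [WithOne.coe_mul, coe_spow, coe_spow, ← pow_succ', ← h2]
  · apply WithOne.coe_injective
    rw [WithOne.coe_mul, coe_spow, coe_spow, ← pow_add]
    have e1 : 2 * k + 1 + (k + 1) = (2 * k + 2) + k := by ring
    rw [e1, pow_add, h2, ← pow_add]; congr 1; omega

theorem aper_idem {T : Type} [Semigroup T] (hT : IsAperiodic T) (t e : T)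
    (he : IsIdempotentElem e) (hk : ∃ k, spow t k = e) : e * t = e ∧ t * e = e := by
  obtain ⟨k, hk⟩ := hk
  obtain ⟨m, hm⟩ := hT t
  have hm' : (t : WithOne T) ^ (m + 1) = (t : WithOne T) ^ (m + 2) := by
    rw [← coe_spow, hm, coe_spow]
  have he' : ∀ j, (e : WithOne T) ^ (j + 1) = e := by
    intro j
    have : IsIdempotentElem (e : WithOne T) := by
      change (e : WithOne T) * e = e
      rw [← WithOne.coe_mul, he]
    exact this.pow_succ_eq j
  have h1 : (e : WithOne T) = (t : WithOne T) ^ ((k + 1) * (m + 1)) := by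
    rw [pow_mul, ← coe_spow, hk, he']
  have h2 : (t : WithOne T) ^ ((k + 1) * (m + 1)) * t = (t : WithOne T) ^ ((k + 1) * (m + 1)) := by
    have e1 : (k + 1) * (m + 1) = k * (m + 1) + (m + 1) := by ring
    rw [e1, pow_add, mul_assoc, ← pow_succ, ← hm']
  constructor
  · apply WithOne.coe_injective
    rw [WithOne.coe_mul, h1, h2]
  · apply WithOne.coe_injective
    rw [WithOne.coe_mul, h1, ← pow_succ', pow_succ, h2]

theorem spow_mul_idem {T : Type} [Semigroup T] {t e : T} (h : t * e = e) (n : ℕ) :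
    spow t n * e = e := by
  induction n with
  | zero => exact h
  | succ n ih =>
    have : spow t (n + 1) = spow t n * t := by
      simp only [spow, Function.iterate_succ_apply']
    rw [this, mul_assoc, h, ih]

theorem idem_mul_spow {T : Type} [Semigroup T] {t e : T} (h : e * t = e) (n : ℕ) :
    e * spow t n = e := by
  induction n with
  | zero => exact h
  | succ n ih =>
    have : spow t (n + 1) = spow t n * t := by
      simp only [spow, Function.iterate_succ_apply']
    rw [this, ← mul_assoc, ih, h]

open scoped Pointwise in
theorem mem_pow_list {M : Type} [Monoid M] (Y : Set M) (L : List M) (h : ∀ x ∈ L, x ∈ Y) :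
    L.prod ∈ Y ^ L.length := by
  induction L with
  | nil => simp
  | cons a L ih =>
    rw [List.prod_cons, List.length_cons, pow_succ']
    exact Set.mul_mem_mul (h a (by simp)) (ih fun x hx => h x (by simp [hx]))

open scoped Pointwise in
theorem exists_list_of_mem_pow {M : Type} [Monoid M] (Y : Set M) (m : ℕ) (y : M)
    (hy : y ∈ Y ^ m) : ∃ L : List M, (∀ x ∈ L, x ∈ Y) ∧ L.length = m ∧ L.prod = y := by
  induction m generalizing y with
  | zero => exact ⟨[], by simp, rfl, by simpa using hy.symm⟩
  | succ m ih =>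
    rw [pow_succ'] at hy
    obtain ⟨a, ha, b, hb, rfl⟩ := Set.mem_mul.1 hy
    obtain ⟨L, h1, h2, rfl⟩ := ih b hb
    refine ⟨a :: L, ?_, by simp [h2], by simp⟩
    intro x hx
    rcases List.mem_cons.1 hx with rfl | hx
    · exact ha
    · exact h1 x hx

open scoped Pointwise in
theorem pump {M : Type} [Monoid M] [Finite M] (Y : Set M) (m : ℕ) (hm : Nat.card M + 2 ≤ m)
    (y : M) (hy : y ∈ Y ^ m) :
    ∃ i l j p q r, p ∈ Y ^ (i + 1) ∧ q ∈ Y ^ (l + 1) ∧ r ∈ Y ^ (j + 1) ∧ p * q = p ∧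
      y = p * r := by
  obtain ⟨L, hL, hlen, rfl⟩ := exists_list_of_mem_pow Y m y hy
  have := Fintype.ofFinite M
  obtain ⟨a, b, hab, h⟩ := Fintype.exists_ne_map_eq_of_card_lt
    (fun i : Fin (Nat.card M + 1) => (L.take (i.1 + 1)).prod) (by simp)
  wlog hlt : a < b generalizing a b
  · exact this b a hab.symm h.symm (lt_of_le_of_ne (not_lt.1 hlt) hab.symm)
  have hlt' : a.1 < b.1 := hlt
  have hb := b.2
  have h' : (L.take (a.1 + 1)).prod = (L.take (b.1 + 1)).prod := h
  have hsplit : L.take (b.1 + 1) = L.take (a.1 + 1) ++ (L.drop (a.1 + 1)).take (b.1 - a.1) := by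
    rw [← List.take_add]; congr 1; omega
  refine ⟨a.1, b.1 - a.1 - 1, m - b.1 - 2, (L.take (a.1 + 1)).prod,
    ((L.drop (a.1 + 1)).take (b.1 - a.1)).prod, (L.drop (b.1 + 1)).prod, ?_, ?_, ?_, ?_, ?_⟩
  · convert mem_pow_list Y (L.take (a.1 + 1)) (fun x hx => hL x (List.mem_of_mem_take hx)) using 2
    rw [List.length_take]; omega
  · convert mem_pow_list Y ((L.drop (a.1 + 1)).take (b.1 - a.1))
      (fun x hx => hL x (List.mem_of_mem_drop (List.mem_of_mem_take hx))) using 2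
    rw [List.length_take, List.length_drop]; omega
  · convert mem_pow_list Y (L.drop (b.1 + 1)) (fun x hx => hL x (List.mem_of_mem_drop hx)) using 2
    rw [List.length_drop]; omega
  · rw [← List.prod_append, ← hsplit, h']
  · rw [h', ← List.prod_append, List.take_append_drop]

/-- `Y` is realised by κ-terms with a common value in every aperiodic semigroup. -/
def GoodK {A S : Type} [Semigroup S] (f : A → S) (Y : Set (WithOne S)) : Prop :=
  ∃ w : WithOne S → KTerm A, (∀ y ∈ Y, ∃ s : S, y = s ∧ KEval f (w y) s) ∧
    ∀ (T : Type) [Semigroup T] [Finite T], IsAperiodic T → ∀ g : A → T,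
      ∃ t : T, ∀ y ∈ Y, KEval g (w y) t

/-- As `GoodK`, with idempotent value. -/
def GoodI {A S : Type} [Semigroup S] (f : A → S) (Y : Set (WithOne S)) : Prop :=
  ∃ w : WithOne S → KTerm A, (∀ y ∈ Y, ∃ s : S, y = s ∧ KEval f (w y) s) ∧
    ∀ (T : Type) [Semigroup T] [Finite T], IsAperiodic T → ∀ g : A → T,
      ∃ t : T, IsIdempotentElem t ∧ ∀ y ∈ Y, KEval g (w y) t

theorem GoodI.goodK {A S : Type} [Semigroup S] {f : A → S} {Y : Set (WithOne S)}
    (h : GoodI f Y) : GoodK f Y := by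
  obtain ⟨w, h1, h2⟩ := h
  refine ⟨w, h1, fun T _ _ hT g => ?_⟩
  obtain ⟨t, _, h⟩ := h2 T hT g
  exact ⟨t, h⟩

open scoped Pointwise in
theorem GoodK.mul {A S : Type} [Semigroup S] {f : A → S} {Y Z : Set (WithOne S)}
    (hY : GoodK f Y) (hZ : GoodK f Z) : GoodK f (Y * Z) := by
  obtain ⟨w, h1, h2⟩ := hY
  obtain ⟨w', h1', h2'⟩ := hZ
  have h : ∀ y ∈ Y * Z, ∃ a b, a ∈ Y ∧ b ∈ Z ∧ a * b = y := by
    intro y hy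
    obtain ⟨a, ha, b, hb, h⟩ := Set.mem_mul.1 hy
    exact ⟨a, b, ha, hb, h⟩
  choose! a b ha hb hab using h
  refine ⟨fun y => KTerm.mul (w (a y)) (w' (b y)), ?_, ?_⟩
  · intro y hy
    obtain ⟨s, hs, e⟩ := h1 _ (ha y hy)
    obtain ⟨s', hs', e'⟩ := h1' _ (hb y hy)
    exact ⟨s * s', by rw [WithOne.coe_mul, ← hs, ← hs', hab y hy], KEval.mul e e'⟩
  · intro T _ _ hT g
    obtain ⟨t, ht⟩ := h2 T hT g
    obtain ⟨t', ht'⟩ := h2' T hT g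
    exact ⟨t * t', fun y hy => KEval.mul (ht _ (ha y hy)) (ht' _ (hb y hy))⟩

open scoped Pointwise in
theorem pow_term {A S : Type} [Semigroup S] {f : A → S} {Y : Set (WithOne S)}
    (w : WithOne S → KTerm A) (h1 : ∀ y ∈ Y, ∃ s : S, y = s ∧ KEval f (w y) s) (n : ℕ) :
    ∀ y ∈ Y ^ (n + 1), ∃ u : KTerm A, (∃ s : S, y = s ∧ KEval f u s) ∧
      ∀ (T : Type) [Semigroup T] (g : A → T) (t : T), (∀ y ∈ Y, KEval g (w y) t) →
        KEval g u (spow t n) := by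
  induction n with
  | zero =>
    intro y hy
    rw [zero_add, pow_one] at hy
    exact ⟨w y, h1 y hy, fun T _ g t ht => ht y hy⟩
  | succ n ih =>
    intro y hy
    rw [pow_succ] at hy
    obtain ⟨a, ha, b, hb, rfl⟩ := Set.mem_mul.1 hy
    obtain ⟨u, ⟨s, hs, e⟩, hu⟩ := ih a ha
    obtain ⟨s', hs', e'⟩ := h1 b hb
    refine ⟨KTerm.mul u (w b), ⟨s * s', by rw [WithOne.coe_mul, hs, hs'], KEval.mul e e'⟩, ?_⟩
    intro T _ g t ht
    have : spow t (n + 1) = spow t n * t := by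
      simp only [spow, Function.iterate_succ_apply']
    rw [this]
    exact KEval.mul (hu T g t ht) (ht b hb)

open scoped Pointwise in
theorem GoodK.nat {A S : Type} [Nonempty A] [Semigroup S] [Finite S] {f : A → S}
    {Y : Set (WithOne S)} (hY : GoodK f Y) :
    GoodI f (⋃ m ≥ Nat.card (WithOne S) + 2, Y ^ m) := by
  obtain ⟨w, h1, h2⟩ := hY
  have : Nonempty (KTerm A) := ⟨KTerm.letter (Classical.arbitrary A)⟩
  have key : ∀ y ∈ ⋃ m ≥ Nat.card (WithOne S) + 2, Y ^ m, ∃ u : KTerm A,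
      (∃ s : S, y = s ∧ KEval f u s) ∧
      ∀ (T : Type) [Semigroup T] [Finite T], IsAperiodic T → ∀ (g : A → T) (t e : T),
        (∀ y ∈ Y, KEval g (w y) t) → IsIdempotentElem e → (∃ k, spow t k = e) →
        KEval g u e := by
    intro y hy
    simp only [Set.mem_iUnion] at hy
    obtain ⟨m, hm, hy⟩ := hy
    obtain ⟨i, l, j, p, q, r, hp, hq, hr, hpq, rfl⟩ := pump Y m hm y hy
    obtain ⟨up, ⟨sp, rfl, ep⟩, hup⟩ := pow_term w h1 i p hp
    obtain ⟨uq, ⟨sq, rfl, eq⟩, huq⟩ := pow_term w h1 l q hq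
    obtain ⟨ur, ⟨sr, rfl, er⟩, hur⟩ := pow_term w h1 j r hr
    refine ⟨KTerm.mul (KTerm.mul up (KTerm.mul (KTerm.ommPow uq) uq)) ur, ?_, ?_⟩
    · obtain ⟨e, g, he, hn, hg, hgs, hsg, hge⟩ := exists_omega sq
      refine ⟨sp * (g * sq) * sr, ?_,
        KEval.mul (KEval.mul ep (KEval.mul (KEval.ommPow eq he hn hg hgs hsg hge) eq)) er⟩
      have hpq' : sp * sq = sp := by
        apply WithOne.coe_injective
        rw [WithOne.coe_mul, hpq]
      obtain ⟨n, hn⟩ := hn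
      rw [hgs, ← hn, idem_mul_spow hpq', WithOne.coe_mul]
    · intro T _ _ hT g t e ht he hk
      obtain ⟨e', g', he', hn, hg, hgs, hsg, hge⟩ := exists_omega (spow t l)
      have hk' : ∃ k, spow t k = e' := by
        obtain ⟨n, hn⟩ := hn
        rw [spow_spow] at hn
        exact ⟨_, hn⟩
      obtain ⟨a1, a2⟩ := aper_idem hT t e he hk
      obtain ⟨b1, b2⟩ := aper_idem hT t e' he' hk'
      have hee : e' = e := by
        obtain ⟨k, hk⟩ := hk
        obtain ⟨k', hk'⟩ := hk'
        rw [← spow_mul_idem b2 k, hk, ← hk', idem_mul_spow a1]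
      have := KEval.mul (KEval.mul (hup T g t ht)
        (KEval.mul (KEval.ommPow (huq T g t ht) he' hn hg hgs hsg hge) (huq T g t ht)))
        (hur T g t ht)
      rwa [hgs, spow_mul_idem b2, idem_mul_spow b1, hee] at this
  choose! u hu1 hu2 using key
  refine ⟨u, hu1, fun T _ _ hT g => ?_⟩
  obtain ⟨t, ht⟩ := h2 T hT g
  obtain ⟨e, _, he, hn, _⟩ := exists_omega t
  exact ⟨e, he, fun y hy => hu2 y hy T hT g t e ht he hn⟩

/-- The set of factorizations of `w` modulo `c`. -/
def facts {A : Type} (c : Con (FreeMonoid A)) (w : FreeMonoid A) : Set (c.Quotient × c.Quotient) :=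
  {x | ∃ u v, u * v = w ∧ x = ((u : c.Quotient), (v : c.Quotient))}

theorem fm_split {A : Type} (a b c d : FreeMonoid A) (h : a * b = c * d) :
    (∃ x, c = a * x ∧ b = x * d) ∨ (∃ x, a = c * x ∧ d = x * b) :=
  List.append_eq_append_iff.1 h

theorem facts_mul {A : Type} (c : Con (FreeMonoid A)) (w w' : FreeMonoid A) :
    facts c (w * w') = (fun x => (x.1, x.2 * (w' : c.Quotient))) '' facts c w ∪
      (fun x => ((w : c.Quotient) * x.1, x.2)) '' facts c w' := by
  ext x
  constructor
  · rintro ⟨u, v, h, rfl⟩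
    rcases fm_split u v w w' h with ⟨x, rfl, rfl⟩ | ⟨x, rfl, rfl⟩
    · exact Or.inl ⟨_, ⟨u, x, rfl, rfl⟩, rfl⟩
    · exact Or.inr ⟨_, ⟨x, v, rfl, rfl⟩, rfl⟩
  · rintro (⟨_, ⟨u, v, rfl, rfl⟩, rfl⟩ | ⟨_, ⟨u, v, rfl, rfl⟩, rfl⟩)
    · exact ⟨u, v * w', by rw [mul_assoc], rfl⟩
    · exact ⟨w * u, v, by rw [mul_assoc], rfl⟩

theorem facts_imp {A : Type} (c : Con (FreeMonoid A)) {w w' : FreeMonoid A}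
    (h : facts c w = facts c w') (u v : FreeMonoid A) (huv : u * v = w') :
    ∃ u' v', u' * v' = w ∧ c u' u ∧ c v' v := by
  have : ((u : c.Quotient), (v : c.Quotient)) ∈ facts c w := h ▸ ⟨u, v, huv, rfl⟩
  obtain ⟨u', v', h1, h2⟩ := this
  rw [Prod.mk.injEq, Con.eq, Con.eq] at h2
  exact ⟨u', v', h1, c.symm h2.1, c.symm h2.2⟩

theorem facts_rel {A : Type} (c : Con (FreeMonoid A)) {w w' : FreeMonoid A}
    (h : facts c w = facts c w') : c w w' := by
  obtain ⟨u, v, rfl, h1, h2⟩ := facts_imp c h w' 1 (mul_one _)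
  simpa using c.mul h1 h2

/-- The refinement of a congruence remembering factorizations. -/
def refineCon {A : Type} (c : Con (FreeMonoid A)) : Con (FreeMonoid A) where
  r u v := facts c u = facts c v
  iseqv := ⟨fun _ => rfl, fun h => h.symm, fun h h' => h.trans h'⟩
  mul' {w x y z} h h' := by
    change facts c (w * y) = facts c (x * z)
    rw [facts_mul, facts_mul, h, h', (Con.eq c).2 (facts_rel c h), (Con.eq c).2 (facts_rel c h')]

theorem refineCon_iff {A : Type} (c : Con (FreeMonoid A)) (u v : FreeMonoid A) :
    refineCon c u v ↔ facts c u = facts c v := Iff.rfl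

theorem refineCon_finite {A : Type} (c : Con (FreeMonoid A)) [Finite c.Quotient] :
    Finite (refineCon c).Quotient := by
  apply Finite.of_injective (β := Set (c.Quotient × c.Quotient))
    (fun x => Con.liftOn x (facts c) (fun u v h => h))
  intro a b
  induction a using Con.induction_on
  induction b using Con.induction_on
  intro h
  exact (Con.eq _).2 h

theorem pow_factor {A : Type} (u : FreeMonoid A) (n : ℕ) : ∀ a b : FreeMonoid A,
    a * b = u ^ (n + 1) → ∃ i j x y, i + j = n ∧ x * y = u ∧ a = u ^ i * x ∧ b = y * u ^ j := by
  induction n with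
  | zero =>
    intro a b h
    exact ⟨0, 0, a, b, rfl, by simpa using h, by simp, by simp⟩
  | succ n ih =>
    intro a b h
    rw [pow_succ] at h
    rcases fm_split _ _ _ _ h with ⟨x, h1, rfl⟩ | ⟨x, rfl, h2⟩
    · obtain ⟨i, j, x', y, hij, hu, rfl, rfl⟩ := ih a x h1.symm
      exact ⟨i, j + 1, x', y, by omega, hu, rfl, by rw [pow_succ, mul_assoc]⟩
    · exact ⟨n + 1, 0, x, b, by omega, h2.symm, rfl, by simp⟩

theorem con_pow_stable {A : Type} (c : Con (FreeMonoid A)) (u : FreeMonoid A) (m : ℕ)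
    (h : c (u ^ m) (u ^ (m + 1))) (i : ℕ) (hi : m ≤ i) : c (u ^ i) (u ^ (i + 1)) := by
  obtain ⟨d, rfl⟩ := Nat.exists_eq_add_of_le hi
  have := c.mul h (c.refl (u ^ d))
  rw [← pow_add, ← pow_add] at this
  convert this using 2
  omega

theorem refineCon_aper {A : Type} (c : Con (FreeMonoid A))
    (h : ∀ u, ∃ m, c (u ^ m) (u ^ (m + 1))) (u : FreeMonoid A) :
    ∃ m, refineCon c (u ^ m) (u ^ (m + 1)) := by
  obtain ⟨m, hm⟩ := h u
  refine ⟨2 * m + 1, ?_⟩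
  rw [refineCon_iff]
  ext z
  constructor
  · rintro ⟨a, b, hab, rfl⟩
    obtain ⟨i, j, x, y, hij, rfl, rfl, rfl⟩ := pow_factor u _ a b hab
    rcases (by omega : m ≤ i ∨ m ≤ j) with hi | hj
    · refine ⟨(x * y) ^ (i + 1) * x, y * (x * y) ^ j, ?_, ?_⟩
      · rw [mul_assoc, ← mul_assoc x, ← pow_succ', ← pow_add]; congr 1; omega
      · rw [Prod.mk.injEq]
        exact ⟨(Con.eq c).2 (c.mul (con_pow_stable c _ m hm i hi) (c.refl _)), rfl⟩
    · refine ⟨(x * y) ^ i * x, y * (x * y) ^ (j + 1), ?_, ?_⟩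
      · rw [mul_assoc, ← mul_assoc x, ← pow_succ', ← pow_add]; congr 1; omega
      · rw [Prod.mk.injEq]
        exact ⟨rfl, (Con.eq c).2 (c.mul (c.refl _) (con_pow_stable c _ m hm j hj))⟩
  · rintro ⟨a, b, hab, rfl⟩
    obtain ⟨i, j, x, y, hij, rfl, rfl, rfl⟩ := pow_factor u _ a b hab
    rcases (by omega : m + 1 ≤ i ∨ m + 1 ≤ j) with hi | hj
    · obtain ⟨i, rfl⟩ : ∃ k, i = k + 1 := ⟨i - 1, by omega⟩
      refine ⟨(x * y) ^ i * x, y * (x * y) ^ j, ?_, ?_⟩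
      · rw [mul_assoc, ← mul_assoc x, ← pow_succ', ← pow_add]; congr 1; omega
      · rw [Prod.mk.injEq]
        exact ⟨((Con.eq c).2 (c.mul (con_pow_stable c _ m hm i (by omega)) (c.refl _))).symm, rfl⟩
    · obtain ⟨j, rfl⟩ : ∃ k, j = k + 1 := ⟨j - 1, by omega⟩
      refine ⟨(x * y) ^ i * x, y * (x * y) ^ j, ?_, ?_⟩
      · rw [mul_assoc, ← mul_assoc x, ← pow_succ', ← pow_add]; congr 1
      · rw [Prod.mk.injEq]
        exact ⟨rfl, ((Con.eq c).2 (c.mul (c.refl _) (con_pow_stable c _ m hm j (by omega)))).symm⟩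

open scoped Pointwise in
theorem exists_deep_con {A N : Type} [Monoid N] (φ : FreeMonoid A →* N)
    (c₀ : Con (FreeMonoid A)) (hfin : Finite c₀.Quotient)
    (hap : ∀ u, ∃ m, c₀ (u ^ m) (u ^ (m + 1))) (k : ℕ) :
    ∃ c : Con (FreeMonoid A), Finite c.Quotient ∧ (∀ u, ∃ m, c (u ^ m) (u ^ (m + 1))) ∧
      (∀ u v, c u v → c₀ u v) ∧
      ∀ u w, c w (w * w) → c u w → φ u ∈ {x | ∃ v, c₀ v w ∧ φ v = x} ^ (k + 1) := by
  induction k with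
  | zero =>
    refine ⟨c₀, hfin, hap, fun _ _ h => h, fun u w _ h => ?_⟩
    rw [zero_add, pow_one]
    exact ⟨u, h, rfl⟩
  | succ k ih =>
    obtain ⟨c, h1, h2, h3, h4⟩ := ih
    refine ⟨refineCon c, refineCon_finite c, refineCon_aper c h2,
      fun u v h => h3 _ _ (facts_rel c h), fun u w hw hu => ?_⟩
    obtain ⟨a, b, rfl, ha, hb⟩ := facts_imp c
      ((refineCon_iff _ _ _).1 ((refineCon c).trans hu hw)) w w rfl
    rw [map_mul, pow_succ]
    exact Set.mul_mem_mul (h4 a w (facts_rel c hw) ha) ⟨b, h3 _ _ hb, rfl⟩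

open scoped Pointwise in
/-- The ordered monoid of sets realised by κ-terms. -/
def GoodSets {A S : Type} [Semigroup S] (f : A → S) : Submonoid (Set (WithOne S)) where
  carrier := {Y | Y = 1 ∨ GoodK f Y}
  one_mem' := Or.inl rfl
  mul_mem' := by
    rintro Y Z (rfl | hY) (rfl | hZ)
    · exact Or.inl (one_mul _)
    · rw [one_mul]; exact Or.inr hZ
    · rw [mul_one]; exact Or.inr hY
    · exact Or.inr (hY.mul hZ)

open scoped Pointwise in
theorem goodSets_nat_mem {A S : Type} [Nonempty A] [Semigroup S] [Finite S] (f : A → S)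
    (Y : GoodSets f) : (⋃ m ≥ Nat.card (WithOne S) + 2, Y.1 ^ m) ∈ GoodSets f := by
  rcases Y.2 with h | h
  · left
    rw [h]
    simp only [one_pow]
    ext x
    simp only [Set.mem_iUnion, exists_prop]
    exact ⟨fun ⟨_, _, h⟩ => h, fun h => ⟨_, le_rfl, h⟩⟩
  · exact Or.inr h.nat.goodK

open scoped Pointwise in
noncomputable instance goodSets_natOM {A S : Type} [Nonempty A] [Semigroup S] [Finite S]
    (f : A → S) : NatOM (GoodSets f) where
  le Y Z := Y.1 ⊆ Z.1
  le_refl Y := Set.Subset.refl Y.1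
  le_trans _ _ _ h h' := Set.Subset.trans h h'
  mul_le a b c d h h' := Set.mul_subset_mul h h'
  nat Y := ⟨_, goodSets_nat_mem f Y⟩
  pow_le_nat := by
    refine ⟨Nat.card (WithOne S) + 2, fun x m hm => ?_⟩
    change (x ^ m).1 ⊆ ⋃ m ≥ Nat.card (WithOne S) + 2, x.1 ^ m
    intro y hy
    simp only [Set.mem_iUnion]
    exact ⟨m, hm, by simpa using hy⟩
  nat_comm x c y h := by
    have h0 : x.1 * c.1 = c.1 * y.1 := congrArg Subtype.val h
    apply Subtype.ext
    change (⋃ m ≥ Nat.card (WithOne S) + 2, x.1 ^ m) * c.1 =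
      c.1 * ⋃ m ≥ Nat.card (WithOne S) + 2, y.1 ^ m
    have h1 : ∀ m, x.1 ^ m * c.1 = c.1 * y.1 ^ m := by
      intro m
      induction m with
      | zero => simp
      | succ m ih => rw [pow_succ, mul_assoc, h0, ← mul_assoc, ih, mul_assoc, ← pow_succ]
    rw [Set.iUnion₂_mul, Set.mul_iUnion₂]
    simp only [h1]

open scoped Pointwise in
/-- The pseudovariety `A` of finite aperiodic semigroups is κ-reducible for
idempotent pointlike sets. -/
theorem aperiodic_kappa_reducible_for_idempotent_pointlikes
    {S : Type} [Semigroup S] [Finite S]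
    (P : Set S) (hP : IsAperiodicIdempotentPointlike P)
    (A : Type) [Finite A]
    (φ : FreeSemigroup A →ₙ* S) (hφ : Function.Surjective φ) :
    ∃ w : P → KTerm A,
      (∀ p : P, KEval (fun a => φ (FreeSemigroup.of a)) (w p) (p : S)) ∧
      (∀ (T : Type) [Semigroup T] [Finite T], IsAperiodic T →
        ∀ f : A → T, ∃ t : T, IsIdempotentElem t ∧ ∀ p : P, KEval f (w p) t) := by
  have hA : Nonempty A := by
    by_contra hA
    rw [not_nonempty_iff] at hA
    have hS : IsEmpty S := ⟨fun s => by
      obtain ⟨u, _⟩ := hφ s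
      exact hA.false u.head⟩
    obtain ⟨t, _⟩ := hP S (fun t => (hS.false t).elim) ⊤ (fun s => (hS.false s).elim)
    exact hS.false t
  rcases P.eq_empty_or_nonempty with rfl | hPne
  · refine ⟨fun p => p.2.elim, fun p => p.2.elim, fun T _ _ hT f => ?_⟩
    obtain ⟨e, _, he, _⟩ := exists_omega (f (Classical.arbitrary A))
    exact ⟨e, he, fun p => p.2.elim⟩
  set f : A → S := fun a => φ (FreeSemigroup.of a) with hf
  let φ' : FreeMonoid A →* WithOne S := FreeMonoid.lift (fun a => (f a : WithOne S))
  have hφ' : ∀ s : S, ∃ w, φ' w = (s : WithOne S) := by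
    intro s
    obtain ⟨u, rfl⟩ := hφ s
    induction u using FreeSemigroup.recOnMul with
    | ih1 a => exact ⟨FreeMonoid.of a, by simp [φ', hf]⟩
    | ih2 a u h1 h2 =>
      obtain ⟨w, hw⟩ := h1
      obtain ⟨w', hw'⟩ := h2
      exact ⟨w * w', by rw [map_mul, map_mul, hw, hw', WithOne.coe_mul]⟩
  have hsing : ∀ a : A, ({(f a : WithOne S)} : Set (WithOne S)) ∈ GoodSets f := by
    intro a
    right
    refine ⟨fun _ => KTerm.letter a, ?_, fun T _ _ _ g => ⟨g a, fun _ _ => KEval.letter a⟩⟩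
    rintro y rfl
    exact ⟨f a, rfl, KEval.letter a⟩
  let β : FreeMonoid A →* GoodSets f := FreeMonoid.lift (fun a => ⟨_, hsing a⟩)
  have hβ : ∀ w, φ' w ∈ (β w).1 := by
    intro w
    induction w using FreeMonoid.inductionOn' with
    | one => simp
    | of_mul a w ih =>
      rw [map_mul, map_mul]
      refine Set.mul_mem_mul ?_ ih
      simp [φ', β]
  obtain ⟨T, _, hTfin, hTap, η, ub, hub⟩ := aperBound_all _ (GoodSets f) rfl _ A rfl β
  have hk : Finite (Con.ker η).Quotient :=
    Finite.of_injective _ (Con.kerLift_injective η)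
  obtain ⟨c, hcfin, hcap, hc0, hc⟩ := exists_deep_con φ' (Con.ker η) hk (fun u => by
    obtain ⟨m, hm⟩ := hTap (η u)
    exact ⟨m, by rw [Con.ker_rel, map_pow, map_pow, hm]⟩) (Nat.card (WithOne S) + 1)
  let R : Subsemigroup (S × c.Quotient) :=
    { carrier := {x | ∃ w : FreeMonoid A, φ' w = (x.1 : WithOne S) ∧ (w : c.Quotient) = x.2}
      mul_mem' := by
        rintro ⟨s, t⟩ ⟨s', t'⟩ ⟨w, h1, h2⟩ ⟨w', h1', h2'⟩
        refine ⟨w * w', ?_, ?_⟩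
        · rw [map_mul, h1, h1']; rfl
        · rw [Con.coe_mul, h2, h2']; rfl }
  obtain ⟨t, ht, hPt⟩ := hP c.Quotient (by
    intro t
    induction t using Con.induction_on with
    | H u =>
      obtain ⟨m, hm⟩ := hcap u
      refine ⟨m, ?_⟩
      rw [spow_eq_pow, spow_eq_pow, pow_succ, pow_succ _ (m + 1)]
      congr 1
      exact (Con.eq c).2 hm) R (fun s => by
    obtain ⟨w, hw⟩ := hφ' s
    exact ⟨(w : c.Quotient), w, hw, rfl⟩)
  induction t using Con.induction_on with
  | H w =>
    have hw : c w (w * w) := c.symm ((Con.eq c).1 ht)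
    let Q : Set (WithOne S) := {x | ∃ v, Con.ker η v w ∧ φ' v = x}
    have hQub : Q ⊆ (ub (η w)).1 := by
      rintro x ⟨v, hv, rfl⟩
      rw [← (Con.ker_rel η).1 hv]
      exact hub v (hβ v)
    have hPQ : ∀ p ∈ P, ∃ v, c v w ∧ φ' v = (p : WithOne S) := by
      intro p hp
      obtain ⟨v, h1, h2⟩ := hPt p hp
      exact ⟨v, (Con.eq c).1 h2, h1⟩
    have hgood : GoodK f (ub (η w)).1 := by
      rcases (ub (η w)).2 with h | h
      · exfalso
        obtain ⟨p, hp⟩ := hPne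
        obtain ⟨v, h1, h2⟩ := hPQ p hp
        have : (p : WithOne S) ∈ (ub (η w)).1 := hQub ⟨v, hc0 _ _ h1, h2⟩
        rw [h] at this
        exact WithOne.coe_ne_one (Set.mem_one.1 this)
      · exact h
    obtain ⟨k, hk1, hk2⟩ := hgood.nat
    have hmem : ∀ p ∈ P, (p : WithOne S) ∈
        ⋃ m ≥ Nat.card (WithOne S) + 2, (ub (η w)).1 ^ m := by
      intro p hp
      obtain ⟨v, h1, h2⟩ := hPQ p hp
      have h3 := hc v w hw h1
      rw [h2] at h3
      simp only [Set.mem_iUnion]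
      exact ⟨_, le_rfl, Set.pow_subset_pow_left hQub h3⟩
    refine ⟨fun p => k (p : S), ?_, ?_⟩
    · intro p
      obtain ⟨s, h1, h2⟩ := hk1 _ (hmem p p.2)
      rw [WithOne.coe_inj] at h1
      rw [← h1] at h2
      exact h2
    · intro T _ _ hT g
      obtain ⟨t, h1, h2⟩ := hk2 T hT g
      exact ⟨t, h1, fun p => h2 _ (hmem p p.2)⟩
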